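/- Let L be an orthocomplemented simple closure space on Σ and z ∈ L. Then z is central — i.e. the set-complement z^c = Σ∖z belongs to L and both (z, z^c) and (z^c, z) are modular pairs — if and only if z⊥ = z^c. -/

import Mathlib

open Set

namespace QLTensor

universe u v w

/-- A simple closure space on `X`: a set of subsets of `X`, closed under arbitrary
set-intersections, containing `∅`, `univ` and all singletons. -/
def IsSCS {X : Type*} (L : Set (Set X)) : Prop :=
  (∀ ω ⊆ L, ⋂₀ ω ∈ L) ∧ ∅ ∈ L ∧ Set.univ ∈ L ∧ ∀ p : X, ({p} : Set X) ∈ L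

/-- The join in a simple closure space: `⋁ A = ⋂ {b ∈ L | A ⊆ b}`. -/
def cl {X : Type*} (L : Set (Set X)) (A : Set X) : Set X :=
  ⋂₀ {b | b ∈ L ∧ A ⊆ b}

/-- `b` covers `a` in the lattice `L` (both belonging to `L`). -/
def CoversIn {X : Type*} (L : Set (Set X)) (a b : Set X) : Prop :=
  a ∈ L ∧ b ∈ L ∧ a ⊂ b ∧ ∀ c ∈ L, a ⊂ c → c ⊂ b → False

/-- `x` is a coatom of `L` (covered by the top element `univ`). -/
def IsCoatomIn {X : Type*} (L : Set (Set X)) (x : Set X) : Prop :=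
  x ∈ L ∧ x ≠ Set.univ ∧ ∀ c ∈ L, x ⊂ c → c = Set.univ

/-- `L` is coatomistic: every element is an intersection of coatoms. -/
def Coatomistic {X : Type*} (L : Set (Set X)) : Prop :=
  ∀ a ∈ L, a = ⋂₀ {x | IsCoatomIn L x ∧ a ⊆ x}

/-- The covering property: if `p ∧ a = 0` then `p ∨ a` covers `a`. -/
def CovProp {X : Type*} (L : Set (Set X)) : Prop :=
  ∀ p : X, ∀ a ∈ L, p ∉ a → CoversIn L a (cl L (insert p a))

/-- The covering property of the dual lattice. -/
def DualCovProp {X : Type*} (L : Set (Set X)) : Prop :=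
  ∀ x : Set X, IsCoatomIn L x → ∀ a ∈ L, cl L (a ∪ x) = Set.univ →
    CoversIn L (a ∩ x) a

/-- A DAC-lattice: `L` and its dual are atomistic with the covering property
(a simple closure space is automatically atomistic). -/
def IsDAC {X : Type*} (L : Set (Set X)) : Prop :=
  CovProp L ∧ Coatomistic L ∧ DualCovProp L

/-- `(a, b)` is a modular pair: `(c ∨ a) ∧ b = c ∨ (a ∧ b)` for all `c ≤ b`. -/
def ModularPairIn {X : Type*} (L : Set (Set X)) (a b : Set X) : Prop :=
  ∀ c ∈ L, c ⊆ b → cl L (c ∪ a) ∩ b = cl L (c ∪ a ∩ b)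

/-- `z` is a central element of the simple closure space `L`. -/
def IsCentralIn {X : Type*} (L : Set (Set X)) (z : Set X) : Prop :=
  zᶜ ∈ L ∧ ModularPairIn L z zᶜ ∧ ModularPairIn L zᶜ z

/-- `L` is irreducible: its only central elements are `∅` and `univ`. -/
def IrreducibleSCS {X : Type*} (L : Set (Set X)) : Prop :=
  ∀ z ∈ L, IsCentralIn L z → z = ∅ ∨ z = Set.univ

/-- `N` is an orthocomplementation of the simple closure space `L`. -/
def IsOrtho {X : Type*} (L : Set (Set X)) (N : Set X → Set X) : Prop :=
  (∀ a ∈ L, N a ∈ L) ∧ (∀ a ∈ L, N (N a) = a) ∧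
  (∀ a ∈ L, ∀ b ∈ L, a ⊆ b → N b ⊆ N a) ∧
  ∀ a ∈ L, cl L (a ∪ N a) = Set.univ

/-- `L` with orthocomplementation `N` is orthomodular. -/
def OrthomodularIn {X : Type*} (L : Set (Set X)) (N : Set X → Set X) : Prop :=
  ∀ a ∈ L, ∀ b ∈ L, a ⊆ b → b = cl L (a ∪ b ∩ N a)

/-- `L` contains `MO₃`. -/
def ContainsMO3 {X : Type*} (L : Set (Set X)) : Prop :=
  ∃ p q r : X, p ≠ q ∧ p ≠ r ∧ q ≠ r ∧
    CoversIn L {p} (cl L {p, q}) ∧ CoversIn L {q} (cl L {p, q}) ∧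
    CoversIn L {r} (cl L {p, q})

/-- `L` contains `MO₄`. -/
def ContainsMO4 {X : Type*} (L : Set (Set X)) : Prop :=
  ∃ p₁ p₂ p₃ p₄ : X,
    p₁ ≠ p₂ ∧ p₁ ≠ p₃ ∧ p₁ ≠ p₄ ∧ p₂ ≠ p₃ ∧ p₂ ≠ p₄ ∧ p₃ ≠ p₄ ∧
    CoversIn L {p₁} (cl L {p₁, p₄}) ∧ CoversIn L {p₂} (cl L {p₁, p₄}) ∧
    CoversIn L {p₃} (cl L {p₁, p₄}) ∧ CoversIn L {p₄} (cl L {p₁, p₄})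

/-- `L` is connected. -/
def ConnectedSCS {X : Type*} (L : Set (Set X)) : Prop :=
  (∃ p q : X, p ≠ q) ∧
  ∀ p q : X, p ≠ q → ∃ r : X, r ≠ p ∧ r ≠ q ∧ r ∈ cl L {p, q} ∧
    p ∈ cl L {q, r} ∧ q ∈ cl L {p, r}

/-- `L` is weakly connected: `L ≠ 2` and the point set admits a connected covering. -/
def WeaklyConnected {X : Type*} (L : Set (Set X)) : Prop :=
  (∃ p q : X, p ≠ q) ∧
  ∃ 𝒜 : Set (Set X),
    ⋃₀ 𝒜 = Set.univ ∧
    (∀ A ∈ 𝒜, ∃ p ∈ A, ∃ q ∈ A, p ≠ q) ∧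
    (∀ A ∈ 𝒜, ∀ p ∈ A, ∀ q ∈ A, p ≠ q → ∃ r, r ≠ p ∧ r ≠ q ∧ r ∈ cl L {p, q}) ∧
    ∀ p q : X, ∃ (m : ℕ) (c : Fin (m + 1) → Set X),
      (∀ i, c i ∈ 𝒜) ∧ p ∈ c 0 ∧ q ∈ c (Fin.last m) ∧
      ∀ i : Fin m, ∃ x ∈ c i.castSucc ∩ c i.succ, ∃ y ∈ c i.castSucc ∩ c i.succ, x ≠ y

/-- The central cover `e(p)` of an atom `p`. -/
def centralCover {X : Type*} (L : Set (Set X)) (p : X) : Set X :=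
  ⋂₀ {z | z ∈ L ∧ IsCentralIn L z ∧ p ∈ z}

/-- The interval `[0, e]` of `L`, viewed as a simple closure space on `e`. -/
def restrictSCS {X : Type*} (L : Set (Set X)) (e : Set X) : Set (Set ↥e) :=
  {B | Subtype.val '' B ∈ L}

/-- The automorphism group of `M` acts transitively on points. -/
def TransitiveSCS {X : Type*} (M : Set (Set X)) : Prop :=
  ∀ p q : X, ∃ u : X ≃ X, (∀ a : Set X, a ∈ M ↔ u '' a ∈ M) ∧ u p = q

section Pi

variable {Ω : Type*} {σ : Ω → Type*}

/-- `⋃_α π_α⁻¹ (a α)`. -/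
def unionCyl (a : ∀ α, Set (σ α)) : Set (∀ α, σ α) :=
  {p | ∃ α, p α ∈ a α}

/-- `∏_α a_α`. -/
def prodSet (a : ∀ α, Set (σ α)) : Set (∀ α, σ α) :=
  {p | ∀ α, p α ∈ a α}

/-- `p[A, β]`. -/
def cylSet (p : ∀ α, σ α) (β : Ω) (A : Set (σ β)) : Set (∀ α, σ α) :=
  {q | q β ∈ A ∧ ∀ α, α ≠ β → q α = p α}

/-- `R_β[p]`. -/
def secSet (R : Set (∀ α, σ α)) (β : Ω) (p : ∀ α, σ α) : Set (σ β) :=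
  {x | ∃ q ∈ R, q β = x ∧ ∀ α, α ≠ β → q α = p α}

/-- The separated product `∧○_α L_α`. -/
def wedgeO (L : ∀ α, Set (Set (σ α))) : Set (Set (∀ α, σ α)) :=
  {S | ∃ ω : Set (Set (∀ α, σ α)),
    (∀ y ∈ ω, ∃ a : ∀ α, Set (σ α), (∀ α, a α ∈ L α) ∧ y = unionCyl a) ∧ S = ⋂₀ ω}

/-- The product `∨○_α L_α`. -/
def veeO (L : ∀ α, Set (Set (σ α))) : Set (Set (∀ α, σ α)) :=
  {R | ∀ (β : Ω) (p : ∀ α, σ α), secSet R β p ∈ L β}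

/-- Axiom P2. -/
def AxiomP2 (L : ∀ α, Set (Set (σ α))) (M : Set (Set (∀ α, σ α))) : Prop :=
  ∀ a : ∀ α, Set (σ α), (∀ α, a α ∈ L α) → unionCyl a ∈ M

/-- Axiom P3. -/
def AxiomP3 (L : ∀ α, Set (Set (σ α))) (M : Set (Set (∀ α, σ α))) : Prop :=
  ∀ (p : ∀ α, σ α) (β : Ω) (A : Set (σ β)), cylSet p β A ∈ M → A ∈ L β

/-- `M` is a weak tensor product of the family `L`, i.e. `M ∈ S(L_α, α ∈ Ω)`. -/
def IsWTP (L : ∀ α, Set (Set (σ α))) (M : Set (Set (∀ α, σ α))) : Prop :=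
  IsSCS M ∧ AxiomP2 L M ∧ AxiomP3 L M

/-- `p # q` iff `p_β ⊥_β q_β` for some `β`. -/
def hashRel (N : ∀ α, Set (σ α) → Set (σ α)) (p q : ∀ α, σ α) : Prop :=
  ∃ β, p β ∈ N β {q β}

/-- `R^#`. -/
def sharp (N : ∀ α, Set (σ α) → Set (σ α)) (R : Set (∀ α, σ α)) :
    Set (∀ α, σ α) :=
  {q | ∀ p ∈ R, hashRel N q p}

/-- A join-preserving map `u` is large. -/
def LargeMap (u : Set (∀ α, σ α) → Set (∀ α, σ α)) : Prop :=
  ∀ (β : Ω) (p : ∀ α, σ α),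
    (¬ ∃ x, u (cylSet p β Set.univ) = {x}) ∧ ¬ u Set.univ ⊆ {q | q β = p β}

end Pi

section Binary

variable {X Y : Type*}

/-- The binary product `L₁ ∨○ L₂`. -/
def veeO2 (L1 : Set (Set X)) (L2 : Set (Set Y)) : Set (Set (X × Y)) :=
  {R | (∀ y : Y, {x | (x, y) ∈ R} ∈ L1) ∧ ∀ x : X, {y | (x, y) ∈ R} ∈ L2}

/-- The binary separated product `L₁ ∧○ L₂`. -/
def wedgeO2 (L1 : Set (Set X)) (L2 : Set (Set Y)) : Set (Set (X × Y)) :=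
  {S | ∃ ω : Set (Set (X × Y)),
    (∀ y ∈ ω, ∃ a₁ ∈ L1, ∃ a₂ ∈ L2,
      y = a₁ ×ˢ (Set.univ : Set Y) ∪ (Set.univ : Set X) ×ˢ a₂) ∧
    S = ⋂₀ ω}

end Binary

theorem cl_eq_self {X : Type*} {L : Set (Set X)} {a : Set X} (ha : a ∈ L) : cl L a = a :=
  Subset.antisymm (sInter_subset_of_mem ⟨ha, Subset.rfl⟩) (subset_sInter fun _ hb => hb.2)

theorem IsSCS.inter_mem {X : Type*} {L : Set (Set X)} (hL : IsSCS L) {a b : Set X}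
    (ha : a ∈ L) (hb : b ∈ L) : a ∩ b ∈ L := by
  rw [← sInter_pair]
  exact hL.1 _ (insert_subset ha (singleton_subset_iff.2 hb))

/-- An element of an orthocomplemented simple closure space is disjoint from its
orthocomplement. -/
theorem IsOrtho.inter_eq_empty {X : Type*} {L : Set (Set X)} {N : Set X → Set X}
    (hL : IsSCS L) (hN : IsOrtho L N) {z : Set X} (hz : z ∈ L) : z ∩ N z = ∅ := by
  obtain ⟨hmem, hinv, hanti, hjoin⟩ := hN
  have hw : z ∩ N z ∈ L := hL.inter_mem hz (hmem z hz)
  have h₁ : N z ⊆ N (z ∩ N z) := hanti _ hw _ hz inter_subset_left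
  have h₂ : z ⊆ N (z ∩ N z) := by
    simpa [hinv z hz] using hanti _ hw _ (hmem z hz) inter_subset_right
  have huniv : N (z ∩ N z) = univ := by
    refine univ_subset_iff.1 ?_
    rw [← hjoin z hz]
    exact sInter_subset_of_mem ⟨hmem _ hw, union_subset h₂ h₁⟩
  refine subset_empty_iff.1 ?_
  calc z ∩ N z = N univ := by rw [← huniv, hinv _ hw]
    _ ⊆ N (N ∅) := hanti _ (hmem _ hL.2.1) _ hL.2.2.1 (subset_univ _)
    _ = ∅ := hinv _ hL.2.1

/-- If the orthocomplement of `z` is its set-complement, then `(z, zᶜ)` is a modular pair. -/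
theorem IsOrtho.modularPairIn_compl {X : Type*} {L : Set (Set X)} {N : Set X → Set X}
    (hL : IsSCS L) (hN : IsOrtho L N) {z : Set X} (hz : z ∈ L) (h : N z = zᶜ) :
    ModularPairIn L z zᶜ := by
  obtain ⟨hmem, hinv, hanti, -⟩ := hN
  intro c hc hcz
  rw [inter_compl_self, union_empty, cl_eq_self hc]
  refine Subset.antisymm ?_
    (subset_inter (subset_sInter fun _ hb => subset_union_left.trans hb.2) hcz)
  rintro p ⟨hp, hpz⟩
  have hNz : N z ∈ L := hmem z hz
  have hNc : N c ∈ L := hmem c hc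
  have hd : N c ∩ N z ∈ L := hL.inter_mem hNc hNz
  have hcd : c ⊆ N (N c ∩ N z) := by
    simpa [hinv c hc] using hanti _ hd _ hNc inter_subset_left
  have hzd : z ⊆ N (N c ∩ N z) := by
    simpa [hinv z hz] using hanti _ hd _ hNz inter_subset_right
  have hpd : p ∈ N (N c ∩ N z) := hp _ ⟨hmem _ hd, union_subset hcd hzd⟩
  have hs : ({p} : Set X) ∈ L := hL.2.2.2 p
  have hzp : z ⊆ N {p} := by
    simpa [hinv z hz] using hanti _ hs _ hNz (singleton_subset_iff.2 (h ▸ hpz))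
  have hdp : N c ∩ N z ⊆ N {p} := by
    simpa only [hinv _ hd] using hanti _ hs _ (hmem _ hd) (singleton_subset_iff.2 hpd)
  have hcp : N c ⊆ N {p} := fun q hq => by
    by_cases hqz : q ∈ z
    · exact hzp hqz
    · exact hdp ⟨hq, h ▸ hqz⟩
  have hpc := hanti _ hNc _ (hmem _ hs) hcp
  rw [hinv _ hs, hinv _ hc] at hpc
  exact singleton_subset_iff.1 hpc

/-- in an orthocomplemented simple closure space, `z ∈ L` is central
iff `z⊥ = z^c`. -/
theorem stmt10 {X : Type*} [Nonempty X] (L : Set (Set X)) (hL : IsSCS L)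
    (N : Set X → Set X) (hN : IsOrtho L N) (z : Set X) (hz : z ∈ L) :
    IsCentralIn L z ↔ N z = zᶜ := by
  constructor
  · rintro ⟨-, hmod, -⟩
    have hNz : N z ∈ L := hN.1 z hz
    have hsub : N z ⊆ zᶜ :=
      (disjoint_iff_inter_eq_empty.2 (hN.inter_eq_empty hL hz)).subset_compl_left
    have hc := hmod (N z) hNz hsub
    rw [union_comm, hN.2.2.2 z hz, univ_inter, inter_compl_self, union_empty,
      cl_eq_self hNz] at hc
    exact hc.symm
  · intro h
    have hzc : zᶜ ∈ L := h ▸ hN.1 z hz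
    have h' : N zᶜ = zᶜᶜ := by rw [← h, hN.2.1 z hz, h, compl_compl]
    refine ⟨hzc, hN.modularPairIn_compl hL hz h, ?_⟩
    simpa only [compl_compl] using hN.modularPairIn_compl hL hzc h'

end QLTensor
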